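/- Let f be standard self-concordant on an open convex set dom f ⊆ ℝⁿ, g : ℝⁿ → ℝ ∪ {+∞} proper, lower semicontinuous and convex, F := f + g, x* the unique minimizer of F with ∇²f(x*) ≻ 0. Let {H_k} be symmetric positive definite matrices satisfying the secant equation H_{k+1}(x^{k+1} − x^k) = ∇f(x^{k+1}) − ∇f(x^k), and let x^{k+1} := P^g_{H_k}(H_k x^k − ∇f(x^k)) be the full-step proximal quasi-Newton iterates. If ‖x⁰ − x*‖_{x*} < 1 and the Dennis–Moré condition holds, i.e., ‖(H_k − ∇²f(x*))(x^{k+1} − x^k)‖*_{x*} / ‖x^{k+1} − x^k‖_{x*} → 0 as k → ∞, then {x^k} converges to x* superlinearly: ‖x^{k+1} − x*‖_{x*}/‖x^k − x*‖_{x*} → 0. -/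

import Mathlib

open Matrix Set Filter Topology

noncomputable section

variable {n : ℕ}

/-- Weighted (semi)norm induced by a matrix `H`: `‖z‖_H = √(zᵀ H z)`. -/
def mNorm (H : Matrix (Fin n) (Fin n) ℝ) (z : Fin n → ℝ) : ℝ :=
  Real.sqrt (z ⬝ᵥ H.mulVec z)

/-- Dual weighted norm, `‖z‖*_H = √(zᵀ H⁻¹ z)`. -/
def mDualNorm (H : Matrix (Fin n) (Fin n) ℝ) (z : Fin n → ℝ) : ℝ :=
  Real.sqrt (z ⬝ᵥ H⁻¹.mulVec z)

/-- A function `g : ℝⁿ → ℝ ∪ {+∞}` (modelled with values in `EReal`) is proper. -/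
def EProper (g : (Fin n → ℝ) → EReal) : Prop :=
  (∀ x, g x ≠ ⊥) ∧ ∃ x, g x ≠ ⊤

/-- Convexity of an `EReal`-valued function on `ℝⁿ`. -/
def EConvex (g : (Fin n → ℝ) → EReal) : Prop :=
  ∀ x y : Fin n → ℝ, ∀ a b : ℝ, 0 ≤ a → 0 ≤ b → a + b = 1 →
    g (a • x + b • y) ≤ (a : EReal) * g x + (b : EReal) * g y

/-- `v` is a subgradient of `g` at `x`. -/
def ESubgradAt (g : (Fin n → ℝ) → EReal) (v x : Fin n → ℝ) : Prop :=
  g x ≠ ⊤ ∧ ∀ y, g x + ((v ⬝ᵥ (y - x) : ℝ) : EReal) ≤ g y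

/-- Objective of the proximal subproblem `g(x) + ½ xᵀHx − uᵀx`. -/
def proxObj (H : Matrix (Fin n) (Fin n) ℝ) (g : (Fin n → ℝ) → EReal)
    (u x : Fin n → ℝ) : EReal :=
  g x + ((1 / 2 * (x ⬝ᵥ H.mulVec x) - u ⬝ᵥ x : ℝ) : EReal)

/-- `p` solves the proximal subproblem, i.e. `p = P^g_H(u)`. -/
def IsProxPt (H : Matrix (Fin n) (Fin n) ℝ) (g : (Fin n → ℝ) → EReal)
    (u p : Fin n → ℝ) : Prop :=
  ∀ x, proxObj H g u p ≤ proxObj H g u x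

/-- The continuous linear map `y ↦ vᵀy`. -/
def dotCLM (v : Fin n → ℝ) : (Fin n → ℝ) →L[ℝ] ℝ :=
  LinearMap.toContinuousLinearMap
    { toFun := fun y => v ⬝ᵥ y
      map_add' := fun a b => dotProduct_add v a b
      map_smul' := fun c a => by simp }

/-- `f` is standard self-concordant on the open convex set `D`. -/
def StdSelfConcordantOn (D : Set (Fin n → ℝ)) (f : (Fin n → ℝ) → ℝ) : Prop :=
  IsOpen D ∧ Convex ℝ D ∧ ConvexOn ℝ D f ∧ ContDiffOn ℝ 3 f D ∧
    ∀ x ∈ D, ∀ v : Fin n → ℝ, ∀ t : ℝ, x + t • v ∈ D →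
      |iteratedDeriv 3 (fun s : ℝ => f (x + s • v)) t| ≤
        2 * iteratedDeriv 2 (fun s : ℝ => f (x + s • v)) t ^ ((3 : ℝ) / 2)

open scoped Classical in
/-- The extended objective `F = f + g`, equal to `+∞` outside `dom f`. -/
def Fext (D : Set (Fin n → ℝ)) (f : (Fin n → ℝ) → ℝ) (g : (Fin n → ℝ) → EReal)
    (x : Fin n → ℝ) : EReal :=
  if x ∈ D then (f x : EReal) + g x else ⊤

def omega (t : ℝ) : ℝ := t - Real.log (1 + t)

def omegaStar (t : ℝ) : ℝ := -t - Real.log (1 - t)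

section WeightedNorm

variable {H : Matrix (Fin n) (Fin n) ℝ}

lemma mNorm_nonneg (H : Matrix (Fin n) (Fin n) ℝ) (z : Fin n → ℝ) : 0 ≤ mNorm H z :=
  Real.sqrt_nonneg _

lemma mNorm_smul (H : Matrix (Fin n) (Fin n) ℝ) (c : ℝ) (z : Fin n → ℝ) :
    mNorm H (c • z) = |c| * mNorm H z := by
  simp only [mNorm, mulVec_smul, smul_dotProduct, dotProduct_smul, smul_eq_mul]
  rw [← mul_assoc, Real.sqrt_mul (mul_self_nonneg c), Real.sqrt_mul_self_eq_abs]

lemma Matrix.PosDef.dotProduct_mulVec_self_nonneg (hH : H.PosDef) (z : Fin n → ℝ) :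
    0 ≤ z ⬝ᵥ H *ᵥ z := by
  simpa using hH.posSemidef.dotProduct_mulVec_nonneg z

lemma Matrix.PosDef.dotProduct_mulVec_comm (hH : H.PosDef) (a b : Fin n → ℝ) :
    a ⬝ᵥ H *ᵥ b = b ⬝ᵥ H *ᵥ a := by
  have hs : Hᵀ = H := by simpa using hH.isHermitian.eq
  rw [dotProduct_mulVec, ← mulVec_transpose, hs, dotProduct_comm]

lemma mNorm_sq (hH : H.PosDef) (z : Fin n → ℝ) : mNorm H z ^ 2 = z ⬝ᵥ H *ᵥ z :=
  Real.sq_sqrt (hH.dotProduct_mulVec_self_nonneg z)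

lemma abs_dotProduct_mulVec_le (hH : H.PosDef) (a b : Fin n → ℝ) :
    |a ⬝ᵥ H *ᵥ b| ≤ mNorm H a * mNorm H b := by
  refine abs_le_of_sq_le_sq ?_ (mul_nonneg (mNorm_nonneg _ _) (mNorm_nonneg _ _))
  have h := discrim_le_zero (a := b ⬝ᵥ H *ᵥ b) (b := 2 * (a ⬝ᵥ H *ᵥ b)) (c := a ⬝ᵥ H *ᵥ a) ?_
  · rw [mul_pow, mNorm_sq hH, mNorm_sq hH]
    rw [discrim] at h
    nlinarith
  · intro t
    have h := hH.dotProduct_mulVec_self_nonneg (a + t • b)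
    simp only [mulVec_add, mulVec_smul, add_dotProduct, dotProduct_add, smul_dotProduct,
      dotProduct_smul, smul_eq_mul, hH.dotProduct_mulVec_comm b a] at h
    linarith

lemma mNorm_add_le (hH : H.PosDef) (a b : Fin n → ℝ) :
    mNorm H (a + b) ≤ mNorm H a + mNorm H b := by
  refine abs_le_of_sq_le_sq' ?_ (add_nonneg (mNorm_nonneg _ _) (mNorm_nonneg _ _)) |>.2
  have h := (abs_le.mp (abs_dotProduct_mulVec_le hH a b)).2
  rw [add_sq, mNorm_sq hH, mNorm_sq hH, mNorm_sq hH]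
  simp only [mulVec_add, add_dotProduct, dotProduct_add, hH.dotProduct_mulVec_comm b a]
  linarith

lemma abs_dotProduct_le (hH : H.PosDef) (a b : Fin n → ℝ) :
    |a ⬝ᵥ b| ≤ mDualNorm H a * mNorm H b := by
  have hu : IsUnit H.det := (Matrix.isUnit_iff_isUnit_det H).1 hH.isUnit
  have ha : H *ᵥ (H⁻¹ *ᵥ a) = a := by
    rw [mulVec_mulVec, Matrix.mul_nonsing_inv H hu, one_mulVec]
  have hd : mDualNorm H a = mNorm H (H⁻¹ *ᵥ a) := by
    rw [mDualNorm, mNorm, ha, dotProduct_comm]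
  have h := abs_dotProduct_mulVec_le hH b (H⁻¹ *ᵥ a)
  rwa [ha, dotProduct_comm, ← hd, mul_comm] at h

lemma exists_norm_le_mul_mNorm (hH : H.PosDef) :
    ∃ C > 0, ∀ z : Fin n → ℝ, ‖z‖ ≤ C * mNorm H z := by
  have hd : ∀ i, 0 ≤ mDualNorm H (Pi.single i 1) := fun i => Real.sqrt_nonneg _
  refine ⟨∑ i, mDualNorm H (Pi.single i 1) + 1,
    add_pos_of_nonneg_of_pos (Finset.sum_nonneg fun i _ => hd i) one_pos, fun z => ?_⟩
  have hC := Finset.sum_nonneg fun i (_ : i ∈ Finset.univ) => hd i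
  refine (pi_norm_le_iff_of_nonneg (mul_nonneg (by linarith) (mNorm_nonneg _ _))).2 fun i => ?_
  have h := abs_dotProduct_le hH (Pi.single i 1) z
  rw [single_dotProduct, one_mul] at h
  refine h.trans (mul_le_mul_of_nonneg_right ?_ (mNorm_nonneg _ _))
  have := Finset.single_le_sum (fun i _ => hd i) (Finset.mem_univ i)
  linarith

lemma abs_dotProduct_le_card_mul_norm (a b : Fin n → ℝ) : |a ⬝ᵥ b| ≤ n * (‖a‖ * ‖b‖) := by
  refine (Finset.abs_sum_le_sum_abs _ _).trans ?_
  refine (Finset.sum_le_card_nsmul _ _ (‖a‖ * ‖b‖) fun i _ => ?_).trans (by simp)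
  rw [abs_mul]
  exact mul_le_mul (norm_le_pi_norm a i) (norm_le_pi_norm b i) (abs_nonneg _) (norm_nonneg _)

end WeightedNorm

/-- First-order approximation of a map that is differentiable at `xs`, tested against all
directions in the weighted norm. -/
lemma exists_abs_linearization_error_le {D : Set (Fin n → ℝ)} {F : (Fin n → ℝ) → Fin n → ℝ}
    {H : Matrix (Fin n) (Fin n) ℝ} {xs : Fin n → ℝ} (hD : D ∈ 𝓝 xs) (hH : H.PosDef)
    (hF : HasFDerivAt F (LinearMap.toContinuousLinearMap H.mulVecLin) xs) {ε : ℝ} (hε : 0 < ε) :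
    ∃ r > 0, ∀ y, mNorm H (y - xs) ≤ r → y ∈ D ∧
      ∀ b, |(F y - F xs - H *ᵥ (y - xs)) ⬝ᵥ b| ≤ ε * mNorm H (y - xs) * mNorm H b := by
  obtain ⟨C, hC, hCz⟩ := exists_norm_le_mul_mNorm hH
  have hc : 0 < ε / (C * C * (n + 1)) := by positivity
  have h1 := (hasFDerivAt_iff_isLittleO.1 hF).def hc
  obtain ⟨r, hr, hball⟩ := Metric.eventually_nhds_iff.1 (h1.and hD)
  refine ⟨r / (2 * C), by positivity, fun y hy => ?_⟩
  have hyr : dist y xs < r := by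
    rw [dist_eq_norm]
    calc ‖y - xs‖ ≤ C * mNorm H (y - xs) := hCz _
      _ ≤ C * (r / (2 * C)) := by gcongr
      _ = r / 2 := by field_simp
      _ < r := by linarith
  obtain ⟨h2, h3⟩ := hball hyr
  refine ⟨h3, fun b => ?_⟩
  have h2' : ‖F y - F xs - H *ᵥ (y - xs)‖ ≤ ε / (C * C * (n + 1)) * ‖y - xs‖ := h2
  have hN := mNorm_nonneg H (y - xs)
  have hNb := mNorm_nonneg H b
  calc |(F y - F xs - H *ᵥ (y - xs)) ⬝ᵥ b|
      ≤ n * (‖F y - F xs - H *ᵥ (y - xs)‖ * ‖b‖) := abs_dotProduct_le_card_mul_norm _ _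
    _ ≤ (n + 1) * (ε / (C * C * (n + 1)) * (C * mNorm H (y - xs)) * (C * mNorm H b)) := by
        gcongr
        · linarith
        · exact h2'.trans (by gcongr; exact hCz _)
        · exact hCz _
    _ = ε * mNorm H (y - xs) * mNorm H b := by field_simp

/-- One-sided first-order optimality condition along a segment. -/
lemma HasDerivAt.nonneg_add_sub_of_eventually_le {φ : ℝ → ℝ} {φ' a b : ℝ}
    (hφ : HasDerivAt φ φ' 0)
    (h : ∀ᶠ t in 𝓝[>] (0 : ℝ), φ 0 + a ≤ φ t + ((1 - t) * a + t * b)) :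
    0 ≤ φ' + (b - a) := by
  have ht := hφ.tendsto_slope_zero_right
  suffices a - b ≤ φ' by linarith
  refine ge_of_tendsto ht ?_
  filter_upwards [h, self_mem_nhdsWithin] with t h1 (h2 : 0 < t)
  rw [zero_add, smul_eq_mul, inv_mul_eq_div, le_div_iff₀ h2]
  linarith

lemma HasFDerivAt.hasDerivAt_line {f : (Fin n → ℝ) → ℝ} {v p : Fin n → ℝ}
    (hf : HasFDerivAt f (dotCLM v) p) (d : Fin n → ℝ) :
    HasDerivAt (fun t : ℝ => f (p + t • d)) (v ⬝ᵥ d) 0 := by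
  have h1 : HasDerivAt (fun t : ℝ => p + t • d) d 0 := by
    simpa using ((hasDerivAt_id (0 : ℝ)).smul_const d).const_add p
  have h2 : HasFDerivAt f (dotCLM v) (p + (0 : ℝ) • d) := by simpa using hf
  exact h2.comp_hasDerivAt (0 : ℝ) h1

lemma ConvexOn.add_dotProduct_sub_le {D : Set (Fin n → ℝ)} {f : (Fin n → ℝ) → ℝ}
    {v p q : Fin n → ℝ} (hf : ConvexOn ℝ D f) (hv : HasFDerivAt f (dotCLM v) p)
    (hp : p ∈ D) (hq : q ∈ D) : f p + v ⬝ᵥ (q - p) ≤ f q := by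
  have h := (hv.hasDerivAt_line (q - p)).neg.nonneg_add_sub_of_eventually_le
    (a := f p) (b := f q) ?_
  · linarith
  filter_upwards [Ioc_mem_nhdsGT (zero_lt_one' ℝ)] with t ht
  have h := hf.2 hp hq (by linarith [ht.2] : 0 ≤ 1 - t) ht.1.le (by ring)
  have he : (1 - t) • p + t • q = p + t • (q - p) := by module
  rw [he] at h
  simp only [smul_eq_mul, Pi.neg_apply, zero_smul, add_zero] at h ⊢
  linarith

lemma ConvexOn.gradient_monotone {D : Set (Fin n → ℝ)} {f : (Fin n → ℝ) → ℝ}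
    {v w p q : Fin n → ℝ} (hf : ConvexOn ℝ D f) (hv : HasFDerivAt f (dotCLM v) p)
    (hw : HasFDerivAt f (dotCLM w) q) (hp : p ∈ D) (hq : q ∈ D) :
    0 ≤ (v - w) ⬝ᵥ (p - q) := by
  have h1 := hf.add_dotProduct_sub_le hv hp hq
  have h2 := hf.add_dotProduct_sub_le hw hq hp
  rw [← neg_sub p q, dotProduct_neg] at h1
  rw [sub_dotProduct]
  linarith

section Subgradient

variable {g : (Fin n → ℝ) → EReal}

/-- Convexity of `g` along a segment between two points of its effective domain, in `ℝ`. -/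
lemma EConvex.toReal_le (hg : EConvex g) (hbot : ∀ x, g x ≠ ⊥) {p q : Fin n → ℝ}
    (hp : g p ≠ ⊤) (hq : g q ≠ ⊤) {t : ℝ} (h0 : 0 ≤ t) (h1 : t ≤ 1) :
    ∃ c : ℝ, g (p + t • (q - p)) = c ∧ c ≤ (1 - t) * (g p).toReal + t * (g q).toReal := by
  have h := hg p q (1 - t) t (by linarith) h0 (by ring)
  have he : (1 - t) • p + t • q = p + t • (q - p) := by module
  rw [he, ← EReal.coe_toReal hp (hbot p), ← EReal.coe_toReal hq (hbot q)] at h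
  norm_cast at h
  have htop : g (p + t • (q - p)) ≠ ⊤ := fun h' => by
    rw [h'] at h
    exact absurd (top_le_iff.1 h) (EReal.coe_ne_top _)
  refine ⟨(g (p + t • (q - p))).toReal, (EReal.coe_toReal htop (hbot _)).symm, ?_⟩
  rw [← EReal.coe_toReal htop (hbot _)] at h
  exact_mod_cast h

lemma dotProduct_sub_le_toReal_of_isProxPt (hg : EConvex g) (hbot : ∀ x, g x ≠ ⊥)
    {H : Matrix (Fin n) (Fin n) ℝ} (hH : H.PosDef) {u p q : Fin n → ℝ}
    (hprox : IsProxPt H g u p) (hp : g p ≠ ⊤) (hq : g q ≠ ⊤) :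
    (g p).toReal + (u - H *ᵥ p) ⬝ᵥ (q - p) ≤ (g q).toReal := by
  set d := q - p with hd
  have hφ : HasDerivAt (fun t : ℝ => t * ((H *ᵥ p - u) ⬝ᵥ d) + t * t * (1 / 2 * (d ⬝ᵥ H *ᵥ d)))
      ((H *ᵥ p - u) ⬝ᵥ d) 0 := by
    exact (((hasDerivAt_id (0 : ℝ)).mul_const ((H *ᵥ p - u) ⬝ᵥ d)).add
      (((hasDerivAt_id (0 : ℝ)).mul (hasDerivAt_id (0 : ℝ))).mul_const
        (1 / 2 * (d ⬝ᵥ H *ᵥ d)))).congr_deriv (by simp)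
  have h := hφ.nonneg_add_sub_of_eventually_le (a := (g p).toReal) (b := (g q).toReal) ?_
  · rw [sub_dotProduct] at h ⊢
    linarith
  filter_upwards [Ioc_mem_nhdsGT (zero_lt_one' ℝ)] with t ht
  obtain ⟨c, hc, hle⟩ := hg.toReal_le hbot hp hq ht.1.le ht.2
  have h := hprox (p + t • d)
  rw [proxObj, proxObj, hc, ← EReal.coe_toReal hp (hbot p)] at h
  norm_cast at h
  simp only [mulVec_add, mulVec_smul, add_dotProduct, dotProduct_add, smul_dotProduct,
    dotProduct_smul, smul_eq_mul, hH.dotProduct_mulVec_comm p d] at h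
  rw [sub_dotProduct, dotProduct_comm (H *ᵥ p) d]
  linarith

lemma neg_dotProduct_sub_le_toReal_of_minimizer (hg : EConvex g) (hbot : ∀ x, g x ≠ ⊥)
    {D : Set (Fin n → ℝ)} {f : (Fin n → ℝ) → ℝ} {v p q : Fin n → ℝ} (hD : D ∈ 𝓝 p)
    (hv : HasFDerivAt f (dotCLM v) p) (hmin : ∀ y, Fext D f g p ≤ Fext D f g y)
    (hp : g p ≠ ⊤) (hq : g q ≠ ⊤) :
    (g p).toReal + (-v) ⬝ᵥ (q - p) ≤ (g q).toReal := by
  have h := (hv.hasDerivAt_line (q - p)).nonneg_add_sub_of_eventually_le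
    (a := (g p).toReal) (b := (g q).toReal) ?_
  · rw [neg_dotProduct]
    linarith
  have hcont : Tendsto (fun t : ℝ => p + t • (q - p)) (𝓝[>] 0) (𝓝 p) := by
    have : Continuous (fun t : ℝ => p + t • (q - p)) := by fun_prop
    simpa using (this.tendsto 0).mono_left nhdsWithin_le_nhds
  filter_upwards [Ioc_mem_nhdsGT (zero_lt_one' ℝ), hcont.eventually_mem hD] with t ht htD
  obtain ⟨c, hc, hle⟩ := hg.toReal_le hbot hp hq ht.1.le ht.2
  have h := hmin (p + t • (q - p))
  rw [Fext, Fext, if_pos (mem_of_mem_nhds hD), if_pos htD, hc,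
    ← EReal.coe_toReal hp (hbot p)] at h
  norm_cast at h
  simp only [zero_smul, add_zero]
  linarith

end Subgradient

/-- Growth of a monotone gradient around a point at which its derivative `H` is positive
definite. -/
lemma ConvexOn.half_sq_le_gradient_sub_dotProduct {D : Set (Fin n → ℝ)} {f : (Fin n → ℝ) → ℝ}
    {f' : (Fin n → ℝ) → Fin n → ℝ} {H : Matrix (Fin n) (Fin n) ℝ} {xs z : Fin n → ℝ} {r δ : ℝ}
    (hf : ConvexOn ℝ D f) (hgrad : ∀ x ∈ D, HasFDerivAt f (dotCLM (f' x)) x) (hH : H.PosDef)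
    (hr : ∀ y, mNorm H (y - xs) ≤ r → y ∈ D ∧
      ∀ b, |(f' y - f' xs - H *ᵥ (y - xs)) ⬝ᵥ b| ≤ 1 / 2 * mNorm H (y - xs) * mNorm H b)
    (hδ : 0 < δ) (hδr : δ ≤ r) (hz : z ∈ D) (hzδ : δ ≤ mNorm H (z - xs)) :
    1 / 2 * δ ^ 2 ≤ (f' z - f' xs) ⬝ᵥ (z - xs) := by
  set e := z - xs with he
  set c := δ / mNorm H e with hc
  have hN : 0 < mNorm H e := hδ.trans_le hzδ
  have hc0 : 0 < c := div_pos hδ hN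
  have hc1 : c ≤ 1 := (div_le_one hN).2 hzδ
  have hyN : mNorm H (xs + c • e - xs) = δ := by
    rw [add_sub_cancel_left, mNorm_smul, abs_of_pos hc0, hc, div_mul_cancel₀ _ hN.ne']
  obtain ⟨hy, hlin⟩ := hr (xs + c • e) (hyN.trans_le hδr)
  have hlin := (abs_le.1 (hlin (c • e))).1
  have hsq := mNorm_sq hH (c • e)
  rw [hyN] at hlin
  rw [add_sub_cancel_left] at hyN hlin
  rw [hyN] at hsq hlin
  rw [sub_dotProduct _ (H *ᵥ _), dotProduct_comm (H *ᵥ _), ← hsq, dotProduct_smul,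
    smul_eq_mul] at hlin
  have hQ : 1 / 2 * δ ^ 2 ≤ (f' (xs + c • e) - f' xs) ⬝ᵥ e := by
    have h1 : 1 / 2 * δ ^ 2 ≤ c * ((f' (xs + c • e) - f' xs) ⬝ᵥ e) := by linarith
    have h2 : 0 ≤ (f' (xs + c • e) - f' xs) ⬝ᵥ e :=
      nonneg_of_mul_nonneg_right ((by positivity : 0 ≤ 1 / 2 * δ ^ 2).trans h1) hc0
    nlinarith
  refine hQ.trans ?_
  have hmono := hf.gradient_monotone (hgrad z hz) (hgrad _ hy) hz hy
  rw [show z - (xs + c • e) = (1 - c) • e by rw [he]; module, dotProduct_smul,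
    smul_eq_mul] at hmono
  rcases hc1.eq_or_lt with h1 | h1
  · rw [h1, one_smul, he, add_sub_cancel]
  · have := nonneg_of_mul_nonneg_right hmono (by linarith)
    rw [sub_dotProduct] at this ⊢
    rw [sub_dotProduct]
    linarith

/-- If a step `s` from `z` nearly satisfies the optimality condition at `xs`, then the gradient
gap at `z` is controlled by the length of `s`. -/
lemma ConvexOn.gradient_sub_dotProduct_le_of_step {D : Set (Fin n → ℝ)} {f : (Fin n → ℝ) → ℝ}
    {f' : (Fin n → ℝ) → Fin n → ℝ} {H : Matrix (Fin n) (Fin n) ℝ} {xs z s : Fin n → ℝ}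
    {r σ M : ℝ}
    (hf : ConvexOn ℝ D f) (hgrad : ∀ x ∈ D, HasFDerivAt f (dotCLM (f' x)) x) (hH : H.PosDef)
    (hr0 : 0 < r) (hr : ∀ y, mNorm H (y - xs) ≤ r → y ∈ D ∧
      ∀ b, |(f' y - f' xs - H *ᵥ (y - xs)) ⬝ᵥ b| ≤ 1 / 2 * mNorm H (y - xs) * mNorm H b)
    (hz : z ∈ D) (hM : mNorm H (z - xs) ≤ M) (hσ : mNorm H s = σ) (hσr : σ ≤ r / 2)
    (hs : (f' z - f' xs) ⬝ᵥ (z - xs + s) ≤ 2 * M * σ) :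
    (f' z - f' xs) ⬝ᵥ (z - xs) ≤ σ * (8 * M + 4 * r) := by
  set e := z - xs with he
  set P := f' z - f' xs with hP
  have hM0 : 0 ≤ M := (mNorm_nonneg _ _).trans hM
  have hσ0 : 0 ≤ σ := hσ ▸ mNorm_nonneg H s
  rw [dotProduct_add] at hs
  suffices hq : -(P ⬝ᵥ s) ≤ σ * (6 * M + 4 * r) by nlinarith
  rcases hσ0.eq_or_lt with h0 | hpos
  · obtain ⟨C, -, hC⟩ := exists_norm_le_mul_mNorm hH
    have h := hC s
    rw [hσ, ← h0, mul_zero, norm_le_zero_iff] at h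
    simp [h, ← h0]
  set c := r / σ with hc
  have hc0 : 0 < c := div_pos hr0 hpos
  have hcσ : c * σ = r := div_mul_cancel₀ _ hpos.ne'
  have hw : mNorm H ((-c) • s) = r := by rw [mNorm_smul, abs_neg, abs_of_pos hc0, hσ, hcσ]
  have hyN : mNorm H (xs + (-c) • s - xs) = r := by rw [add_sub_cancel_left, hw]
  obtain ⟨hy, hlin⟩ := hr _ hyN.le
  have hd : z - (xs + (-c) • s) = e + c • s := by rw [he]; module
  have hmono := hf.gradient_monotone (hgrad z hz) (hgrad _ hy) hz hy
  rw [hd, show f' z - f' (xs + (-c) • s) = P - (f' (xs + (-c) • s) - f' xs) by rw [hP]; abel,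
    sub_dotProduct P, dotProduct_add P, dotProduct_smul, smul_eq_mul] at hmono
  have hlin := (abs_le.1 (hlin (e + c • s))).1
  have hcs := (abs_le.1 (abs_dotProduct_mulVec_le hH (e + c • s) ((-c) • s))).1
  have hb : mNorm H (e + c • s) ≤ M + r := by
    refine (mNorm_add_le hH _ _).trans ?_
    rw [mNorm_smul, abs_of_pos hc0, hσ, hcσ]
    linarith
  rw [hyN, add_sub_cancel_left, sub_dotProduct _ (H *ᵥ _), dotProduct_comm (H *ᵥ _)] at hlin
  rw [hw] at hcs
  have hrb : r * mNorm H (e + c • s) ≤ r * (M + r) := by gcongr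
  have hrM : 0 ≤ r * (M + r) := by positivity
  have key : -(c * (P ⬝ᵥ s)) ≤ 2 * M * σ - P ⬝ᵥ s + 2 * (r * (M + r)) := by linarith
  have key2 : r * -(P ⬝ᵥ s) ≤ σ * (2 * M * σ - P ⬝ᵥ s + 2 * (r * (M + r))) := by
    rw [← hcσ] at *
    nlinarith
  by_contra! hcon
  have : (r - σ) * -(P ⬝ᵥ s) ≤ σ * (M * r + 2 * (r * (M + r))) := by
    nlinarith [mul_nonneg (mul_nonneg hM0 hσ0) (sub_nonneg.2 hσr)]
  have : r / 2 * -(P ⬝ᵥ s) ≤ σ * (M * r + 2 * (r * (M + r))) := by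
    have : 0 ≤ -(P ⬝ᵥ s) := le_trans (by positivity) hcon.le
    nlinarith
  have : r / 2 * (σ * (6 * M + 4 * r)) < r / 2 * -(P ⬝ᵥ s) := by gcongr
  nlinarith

lemma tendsto_zero_and_bounded_of_step_halving {σ t : ℕ → ℝ} {K : ℕ} (hσ0 : ∀ k, 0 ≤ σ k)
    (hσ : ∀ k ≥ K, σ (k + 1) ≤ σ k / 2) (ht : ∀ k, t (k + 1) ≤ t k + σ k) :
    Tendsto σ atTop (𝓝 0) ∧ ∃ M, ∀ k ≥ K, t k ≤ M := by
  have h1 : ∀ j, σ (j + K) ≤ σ K * (1 / 2) ^ j := by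
    intro j
    induction j with
    | zero => simp
    | succ j ih =>
      have := hσ (j + K) (by omega)
      rw [show j + 1 + K = j + K + 1 by omega, pow_succ]
      linarith
  have h2 : ∀ j, t (j + K) + 2 * σ (j + K) ≤ t K + 2 * σ K := by
    intro j
    induction j with
    | zero => simp
    | succ j ih =>
      have := hσ (j + K) (by omega)
      have := ht (j + K)
      rw [show j + 1 + K = j + K + 1 by omega]
      linarith
  refine ⟨(tendsto_add_atTop_iff_nat K).1 (squeeze_zero (fun j => hσ0 _) h1 ?_),
    t K + 2 * σ K, fun k hk => ?_⟩
  · simpa using (tendsto_pow_atTop_nhds_zero_of_lt_one (by norm_num : (0 : ℝ) ≤ 1 / 2)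
      (by norm_num)).const_mul (σ K)
  · have := h2 (k - K)
    rw [Nat.sub_add_cancel hk] at this
    linarith [hσ0 k]

lemma dotProduct_sub_nonneg_of_subgradient {G : (Fin n → ℝ) → ℝ} {v w p q : Fin n → ℝ}
    (hv : G p + v ⬝ᵥ (q - p) ≤ G q) (hw : G q + w ⬝ᵥ (p - q) ≤ G p) :
    0 ≤ (v - w) ⬝ᵥ (p - q) := by
  rw [← neg_sub p q, dotProduct_neg] at hv
  rw [sub_dotProduct]
  linarith

/-- Under the secant equation and the Dennis–Moré condition, the full-step
proximal quasi-Newton iterates converge superlinearly to `x*` provided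
`‖x⁰ − x*‖_{x*} < 1`. -/
theorem quasi_newton_superlinear
    (n : ℕ) (D : Set (Fin n → ℝ)) (f : (Fin n → ℝ) → ℝ)
    (f' : (Fin n → ℝ) → Fin n → ℝ)
    (f'' : (Fin n → ℝ) → Matrix (Fin n) (Fin n) ℝ)
    (hf : StdSelfConcordantOn D f)
    (hgrad : ∀ x ∈ D, HasFDerivAt f (dotCLM (f' x)) x)
    (hhess : ∀ x ∈ D,
      HasFDerivAt f' (LinearMap.toContinuousLinearMap (f'' x).mulVecLin) x)
    (g : (Fin n → ℝ) → EReal) (hg_proper : EProper g)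
    (hg_lsc : LowerSemicontinuous g) (hg_conv : EConvex g)
    (x : ℕ → Fin n → ℝ) (Hk : ℕ → Matrix (Fin n) (Fin n) ℝ)
    (hHk : ∀ k, (Hk k).PosDef)
    (hsecant : ∀ k,
      (Hk (k + 1)).mulVec (x (k + 1) - x k) = f' (x (k + 1)) - f' (x k))
    (hdom : ∀ k, x k ∈ D ∧ g (x k) ≠ ⊤)
    (hiter : ∀ k, IsProxPt (Hk k) g ((Hk k).mulVec (x k) - f' (x k)) (x (k + 1)))
    (xs : Fin n → ℝ) (hxsD : xs ∈ D) (hxsg : g xs ≠ ⊤)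
    (hxs_min : ∀ y, Fext D f g xs ≤ Fext D f g y)
    (hxs_uniq : ∀ y, (∀ z, Fext D f g y ≤ Fext D f g z) → y = xs)
    (hxs_pd : (f'' xs).PosDef)
    (hstart : mNorm (f'' xs) (x 0 - xs) < 1)
    (hDM : Tendsto (fun k =>
        mDualNorm (f'' xs) ((Hk k - f'' xs).mulVec (x (k + 1) - x k)) /
          mNorm (f'' xs) (x (k + 1) - x k)) atTop (𝓝 0)) :
    Tendsto (fun k =>
        mNorm (f'' xs) (x (k + 1) - xs) / mNorm (f'' xs) (x k - xs))
      atTop (𝓝 0) := by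
  obtain ⟨hDo, -, hfc, -, -⟩ := hf
  have hDx : D ∈ 𝓝 xs := hDo.mem_nhds hxsD
  set H := f'' xs with hHdef
  obtain ⟨hbot, -⟩ := hg_proper
  set s : ℕ → Fin n → ℝ := fun k => x (k + 1) - x k with hs
  set σ : ℕ → ℝ := fun k => mNorm H (s k) with hσ
  set t : ℕ → ℝ := fun k => mNorm H (x k - xs) with ht
  set ε : ℕ → ℝ := fun k => mDualNorm H ((Hk k - H) *ᵥ s k) / σ k with hε
  have hσ0 : ∀ k, 0 ≤ σ k := fun k => mNorm_nonneg _ _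
  have ht0 : ∀ k, 0 ≤ t k := fun k => mNorm_nonneg _ _
  have hε0 : ∀ k, 0 ≤ ε k := fun k => div_nonneg (Real.sqrt_nonneg _) (hσ0 k)
  have hres : ∀ k b, |(Hk k *ᵥ s k) ⬝ᵥ b - s k ⬝ᵥ H *ᵥ b| ≤ ε k * σ k * mNorm H b := by
    intro k b
    have heq : (Hk k *ᵥ s k) ⬝ᵥ b - s k ⬝ᵥ H *ᵥ b = ((Hk k - H) *ᵥ s k) ⬝ᵥ b := by
      rw [sub_mulVec, sub_dotProduct (Hk k *ᵥ s k), dotProduct_comm (H *ᵥ s k),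
        hxs_pd.dotProduct_mulVec_comm]
    rw [heq]
    refine (abs_dotProduct_le hxs_pd _ _).trans_eq ?_
    rcases eq_or_ne (σ k) 0 with h0 | h0
    · obtain ⟨C, -, hC⟩ := exists_norm_le_mul_mNorm hxs_pd
      have h : s k = 0 := by
        have h := hC (s k)
        rwa [show mNorm H (s k) = 0 from h0, mul_zero, norm_le_zero_iff] at h
      simp [h, h0, mDualNorm]
    · rw [hε]
      simp only
      rw [div_mul_cancel₀ _ h0]
  -- The subgradients of `g` produced by the iteration, and the one at `xs`.
  have hsub : ∀ k y, g y ≠ ⊤ → (g (x (k + 1))).toReal +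
      (-f' (x k) - Hk k *ᵥ s k) ⬝ᵥ (y - x (k + 1)) ≤ (g y).toReal := by
    intro k y hy
    have h := dotProduct_sub_le_toReal_of_isProxPt hg_conv hbot (hHk k) (hiter k)
      (hdom (k + 1)).2 hy
    rwa [show Hk k *ᵥ x k - f' (x k) - Hk k *ᵥ x (k + 1) = -f' (x k) - Hk k *ᵥ s k by
      rw [hs, mulVec_sub]; abel] at h
  have hsubs : ∀ y, g y ≠ ⊤ → (g xs).toReal + (-f' xs) ⬝ᵥ (y - xs) ≤ (g y).toReal :=
    fun y hy => neg_dotProduct_sub_le_toReal_of_minimizer hg_conv hbot hDx (hgrad xs hxsD)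
      hxs_min hxsg hy
  have hstep : ∀ k, (1 - ε (k + 1)) * σ (k + 1) ≤ (ε k + ε (k + 1)) * σ k := by
    intro k
    have hm := dotProduct_sub_nonneg_of_subgradient (G := fun y => (g y).toReal)
      (hsub (k + 1) (x (k + 1)) (hdom _).2) (hsub k (x (k + 1 + 1)) (hdom _).2)
    rw [show x (k + 1 + 1) - x (k + 1) = s (k + 1) from rfl,
      show -f' (x (k + 1)) - Hk (k + 1) *ᵥ s (k + 1) - (-f' (x k) - Hk k *ᵥ s k)
        = Hk k *ᵥ s k - Hk (k + 1) *ᵥ s (k + 1) - (f' (x (k + 1)) - f' (x k)) by abel,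
      ← hsecant k, sub_dotProduct, sub_dotProduct,
      show x (k + 1) - x k = s k from rfl, dotProduct_comm (Hk (k + 1) *ᵥ s k),
      (hHk (k + 1)).dotProduct_mulVec_comm, dotProduct_comm (s k)] at hm
    have h1 := (abs_le.1 (hres k (s (k + 1)))).2
    have h2 := (abs_le.1 (hres (k + 1) (s k))).1
    have h3 := (abs_le.1 (hres (k + 1) (s (k + 1)))).1
    have h4 := mNorm_sq hxs_pd (s (k + 1))
    rw [hxs_pd.dotProduct_mulVec_comm (s (k + 1)) (s k)] at h2
    change _ ≤ ε k * σ k * σ (k + 1) at h1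
    change -(ε (k + 1) * σ (k + 1) * σ k) ≤ _ at h2
    change -(ε (k + 1) * σ (k + 1) * σ (k + 1)) ≤ _ at h3
    change σ (k + 1) ^ 2 = _ at h4
    rcases (hσ0 (k + 1)).eq_or_lt with h0 | hpos
    · rw [← h0, mul_zero]
      exact mul_nonneg (add_nonneg (hε0 _) (hε0 _)) (hσ0 _)
    · refine le_of_mul_le_mul_right ?_ hpos
      linarith
  obtain ⟨K, hK⟩ := eventually_atTop.1
    (hDM.eventually_le_const (by norm_num : (0 : ℝ) < 1 / 8))
  have hK : ∀ k ≥ K, ε k ≤ 1 / 8 := hK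
  have hhalf : ∀ k ≥ K, σ (k + 1) ≤ σ k / 2 := by
    intro k hk
    have h1 := hK k hk
    have h2 := hK (k + 1) (by omega)
    nlinarith [hstep k, hσ0 k, hσ0 (k + 1)]
  have htri : ∀ k, t (k + 1) ≤ t k + σ k := by
    intro k
    have h := mNorm_add_le hxs_pd (x k - xs) (s k)
    rwa [show x k - xs + s k = x (k + 1) - xs by rw [hs]; simp] at h
  have htri' : ∀ k, σ k ≤ t k + t (k + 1) := by
    intro k
    have h := mNorm_add_le hxs_pd (x (k + 1) - xs) ((-1 : ℝ) • (x k - xs))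
    rw [mNorm_smul, abs_neg, abs_one, one_mul,
      show x (k + 1) - xs + (-1 : ℝ) • (x k - xs) = s k by rw [hs]; module] at h
    linarith
  obtain ⟨hσlim, M, hM⟩ := tendsto_zero_and_bounded_of_step_halving hσ0 hhalf htri
  have hopt : ∀ k, (f' (x k) - f' xs) ⬝ᵥ (x (k + 1) - xs)
      ≤ -((Hk k *ᵥ s k) ⬝ᵥ (x (k + 1) - xs)) := by
    intro k
    have hm := dotProduct_sub_nonneg_of_subgradient (G := fun y => (g y).toReal)
      (hsub k xs hxsg) (hsubs (x (k + 1)) (hdom _).2)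
    simp only [sub_dotProduct, neg_dotProduct] at hm ⊢
    linarith
  have htlim : Tendsto t atTop (𝓝 0) := by
    obtain ⟨r, hr0, hr⟩ := exists_abs_linearization_error_le hDx hxs_pd (hhess xs hxsD)
      (by norm_num : (0 : ℝ) < 1 / 2)
    have hgap : ∀ᶠ k in atTop,
        (f' (x k) - f' xs) ⬝ᵥ (x k - xs) ≤ σ k * (8 * M + 4 * r) := by
      filter_upwards [eventually_ge_atTop K,
        hσlim.eventually_le_const (by positivity : 0 < r / 2)] with k hk hσr
      refine hfc.gradient_sub_dotProduct_le_of_step hgrad hxs_pd hr0 hr (hdom k).1 (hM k hk)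
        (s := s k) rfl hσr ?_
      rw [show x k - xs + s k = x (k + 1) - xs by rw [hs]; simp]
      refine (hopt k).trans ?_
      have h1 := (abs_le.1 (hres k (x (k + 1) - xs))).1
      have h2 := (abs_le.1 (abs_dotProduct_mulVec_le hxs_pd (s k) (x (k + 1) - xs))).1
      change -(σ k * t (k + 1)) ≤ _ at h2
      change -(ε k * σ k * t (k + 1)) ≤ _ at h1
      have h3 : σ k * t (k + 1) ≤ σ k * M := by
        have := hM (k + 1) (by omega)
        have := hσ0 k
        gcongr
      have h4 : ε k * (σ k * t (k + 1)) ≤ 1 / 8 * (σ k * t (k + 1)) := by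
        have := hK k hk
        have := mul_nonneg (hσ0 k) (ht0 (k + 1))
        gcongr
      have := mul_nonneg (hσ0 k) (ht0 (k + 1))
      linarith
    refine Metric.tendsto_nhds.2 fun δ hδ => ?_
    have hδ' : 0 < min δ r := lt_min hδ hr0
    have hlim : Tendsto (fun k => σ k * (8 * M + 4 * r)) atTop (𝓝 0) := by
      simpa using hσlim.mul_const (8 * M + 4 * r)
    filter_upwards [hgap, hlim.eventually_lt_const
      (by positivity : 0 < 1 / 2 * min δ r ^ 2)] with k h1 h2
    rw [Real.dist_0_eq_abs, abs_of_nonneg (ht0 k)]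
    by_contra! hcon
    have := hfc.half_sq_le_gradient_sub_dotProduct hgrad hxs_pd hr hδ' (min_le_right _ _)
      (hdom k).1 ((min_le_left _ _).trans hcon)
    linarith
  refine Metric.tendsto_nhds.2 fun η hη => ?_
  have hη' : 0 < min (η / 8) (1 / 8) := by positivity
  set c := min (η / 8) (1 / 8) with hc
  have hc1 : c ≤ 1 / 8 := min_le_right _ _
  have hcη : c ≤ η / 8 := min_le_left _ _
  obtain ⟨r, hr0, hr⟩ := exists_abs_linearization_error_le hDx hxs_pd (hhess xs hxsD) hη'
  have hεlim : Tendsto ε atTop (𝓝 0) := hDM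
  filter_upwards [htlim.eventually_le_const hr0, hεlim.eventually_le_const hη'] with k htk hεk
  change dist (t (k + 1) / t k) 0 < η
  rw [Real.dist_0_eq_abs, abs_of_nonneg (div_nonneg (ht0 _) (ht0 _))]
  suffices h : t (k + 1) ≤ 4 * c * t k by
    refine (div_le_of_le_mul₀ (ht0 k) (by positivity) h).trans_lt ?_
    linarith
  have hle : t (k + 1) * t (k + 1) ≤ (c * t k + ε k * σ k) * t (k + 1) := by
    have h1 := (abs_le.1 ((hr (x k) htk).2 (x (k + 1) - xs))).1
    have h2 := (abs_le.1 (hres k (x (k + 1) - xs))).1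
    have h3 := hopt k
    have h4 := mNorm_sq hxs_pd (x (k + 1) - xs)
    change -(c * t k * t (k + 1)) ≤ _ at h1
    change -(ε k * σ k * t (k + 1)) ≤ _ at h2
    change t (k + 1) ^ 2 = _ at h4
    nth_rw 1 [show x (k + 1) - xs = s k + (x k - xs) by rw [hs]; simp] at h4
    rw [add_dotProduct] at h4
    rw [sub_dotProduct _ (H *ᵥ _), dotProduct_comm (H *ᵥ _),
      hxs_pd.dotProduct_mulVec_comm] at h1
    linarith
  rcases (ht0 (k + 1)).eq_or_lt with h0 | hpos
  · rw [← h0]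
    exact mul_nonneg (by positivity) (ht0 k)
  · have h1 := le_of_mul_le_mul_right hle hpos
    have h2 : ε k * σ k ≤ c * (t k + t (k + 1)) :=
      mul_le_mul hεk (htri' k) (hσ0 k) hη'.le
    nlinarith [ht0 k]
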